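/- Let (M,Q) be a nondegenerate finite quadratic module such that |M| is a perfect square and σ_p(M) = 1 for every prime p. Then Inv(M) ≠ 0; moreover, Inv(M) is spanned over ℂ by the indicator functions 1_U (the elements I_U = Σ_{x∈U} ⟨x⟩), where U runs through the isotropic self-dual subgroups of M. -/

import Mathlib

noncomputable section

/-- `ℚ/ℤ` as the additive circle of circumference 1. -/
abbrev QZ : Type := AddCircle (1 : ℚ)

lemma expPeriodic : Function.Periodic
    (fun q : ℚ => Complex.exp (2 * Real.pi * Complex.I * (q : ℂ))) 1 := by
  intro x
  push_cast
  rw [mul_add, Complex.exp_add, mul_one, Complex.exp_two_pi_mul_I, mul_one]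

/-- The standard character `e : ℚ/ℤ → ℂ`, `e(t) = exp(2πi t)`. -/
def ee : QZ → ℂ := expPeriodic.lift

variable {M : Type} [AddCommGroup M]

/-- The bilinear form associated to a quadratic form `Q : M → ℚ/ℤ`. -/
def Bf (Q : M → QZ) (x y : M) : QZ := Q (x + y) - Q x - Q y

/-- The Gauss sum `σ(M) = |M|^{-1/2} ∑_{x ∈ M} e(-Q(x))`. -/
def gaussSigma (Q : M → QZ) : ℂ :=
  ((Real.sqrt (Nat.card M) : ℂ))⁻¹ * ∑ᶠ x : M, ee (-(Q x))

/-- The operator `T_M` of the Weil representation: `(T_M λ)(x) = e(Q(x))·λ(x)`. -/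
def Tweil (Q : M → QZ) (lam : M → ℂ) : M → ℂ := fun x => ee (Q x) * lam x

/-- The operator `S_M` of the Weil representation:
`(S_M λ)(y) = σ(M)·|M|^{-1/2}·∑_{x∈M} e(-B(y,x))·λ(x)`. -/
def Sweil (Q : M → QZ) (lam : M → ℂ) : M → ℂ := fun y =>
  gaussSigma Q * ((Real.sqrt (Nat.card M) : ℂ))⁻¹ *
    ∑ᶠ x : M, ee (-(Bf Q y x)) * lam x

/-- The `p`-primary component of an abelian group, as a subgroup. -/
def primaryComp (M : Type) [AddCommGroup M] (p : ℕ) : AddSubgroup M where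
  carrier := {x | ∃ k : ℕ, (p ^ k : ℕ) • x = 0}
  zero_mem' := ⟨0, smul_zero _⟩
  add_mem' := by
    rintro a b ⟨k, hk⟩ ⟨l, hl⟩
    refine ⟨k + l, ?_⟩
    have ha : (p ^ (k + l) : ℕ) • a = 0 := by
      rw [pow_add, mul_comm, mul_smul, hk, smul_zero]
    have hb : (p ^ (k + l) : ℕ) • b = 0 := by
      rw [pow_add, mul_smul, hl, smul_zero]
    rw [smul_add, ha, hb, add_zero]
  neg_mem' := by
    rintro a ⟨k, hk⟩
    exact ⟨k, by rw [smul_neg, hk, neg_zero]⟩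

end

section Helpers
open scoped Classical
open Finset
variable {M : Type} [AddCommGroup M]

lemma ee_coe (q : ℚ) : ee (q : QZ) = Complex.exp (2 * Real.pi * Complex.I * (q : ℂ)) :=
  expPeriodic.lift_coe q

lemma ee_add (s t : QZ) : ee (s + t) = ee s * ee t := by
  induction s using QuotientAddGroup.induction_on with
  | H s =>
  induction t using QuotientAddGroup.induction_on with
  | H t =>
  have := ee_coe (s + t)
  push_cast at this
  rw [mul_add, Complex.exp_add, ← ee_coe, ← ee_coe] at this
  exact this

lemma ee_zero : ee 0 = 1 := by
  have := ee_coe 0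
  simpa using this

lemma ee_eq_one {t : QZ} (h : ee t = 1) : t = 0 := by
  induction t using QuotientAddGroup.induction_on with
  | H t =>
  have h2 := ee_coe t
  rw [show ee (t : QZ) = 1 from h] at h2
  obtain ⟨n, hn⟩ := Complex.exp_eq_one_iff.1 h2.symm
  have : (t : ℂ) = n := by
    have h3 : (2 * Real.pi * Complex.I : ℂ) ≠ 0 := Complex.two_pi_I_ne_zero
    apply mul_left_cancel₀ h3
    rw [hn]; ring
  have h4 : t = n := by exact_mod_cast this
  rw [h4]
  refine (AddCircle.coe_eq_zero_iff (1:ℚ)).2 ⟨n, by simp⟩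

lemma ee_neg (t : QZ) : ee (-t) = (ee t)⁻¹ := by
  apply eq_inv_of_mul_eq_one_left
  rw [← ee_add]; simp [ee_zero]

lemma ee_nsmul (n : ℕ) (t : QZ) : ee (n • t) = ee t ^ n := by
  induction n with
  | zero => simp [ee_zero]
  | succ n ih => rw [succ_nsmul, ee_add, ih, pow_succ]

/-- bundled hypotheses -/
structure IsQM (Q : M → QZ) : Prop where
  quad : ∀ (n : ℤ) (x : M), Q (n • x) = (n ^ 2 : ℤ) • Q x
  bil : ∀ x x' y : M, Bf Q (x + x') y = Bf Q x y + Bf Q x' y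
  nd : ∀ x : M, (∀ y : M, Bf Q x y = 0) → x = 0

lemma Bf_symm (Q : M → QZ) (x y : M) : Bf Q x y = Bf Q y x := by
  unfold Bf; rw [add_comm]; abel

lemma Q_add (Q : M → QZ) (x y : M) : Q (x + y) = Q x + Q y + Bf Q x y := by
  unfold Bf; abel

namespace IsQM
variable {Q : M → QZ} (h : IsQM Q)
include h

lemma bilr (x y y' : M) : Bf Q x (y + y') = Bf Q x y + Bf Q x y' := by
  rw [Bf_symm, h.bil, Bf_symm Q y, Bf_symm Q y']

lemma zsl (n : ℤ) (x y : M) : Bf Q (n • x) y = n • Bf Q x y :=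
  map_zsmul (AddMonoidHom.mk' (fun x => Bf Q x y) (fun a b => h.bil a b y)) n x

lemma zsr (n : ℤ) (x y : M) : Bf Q x (n • y) = n • Bf Q x y :=
  map_zsmul (AddMonoidHom.mk' (fun y => Bf Q x y) (fun a b => h.bilr x a b)) n y

lemma zl (y : M) : Bf Q 0 y = 0 := by simpa using h.zsl 0 0 y
lemma zr (y : M) : Bf Q y 0 = 0 := by simpa using h.zsr 0 y 0

lemma nl (x y : M) : Bf Q (-x) y = - Bf Q x y := by simpa using h.zsl (-1) x y
lemma nr (x y : M) : Bf Q x (-y) = - Bf Q x y := by simpa using h.zsr (-1) x y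
lemma sl (x x' y : M) : Bf Q (x - x') y = Bf Q x y - Bf Q x' y := by
  rw [sub_eq_add_neg, h.bil, h.nl, sub_eq_add_neg]
lemma sr (x y y' : M) : Bf Q x (y - y') = Bf Q x y - Bf Q x y' := by
  rw [sub_eq_add_neg, h.bilr, h.nr, sub_eq_add_neg]

lemma Q0 : Q 0 = 0 := by simpa using h.quad 0 0
lemma Qneg (x : M) : Q (-x) = Q x := by simpa using h.quad (-1) x
lemma Qz (n : ℤ) {x : M} (hx : Q x = 0) : Q (n • x) = 0 := by rw [h.quad, hx, smul_zero]
end IsQM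

/-- sums over subgroups of characters -/
lemma charsum [Fintype M] (H : AddSubgroup M) (f : M → QZ)
    (hf : ∀ x y, f (x + y) = f x + f y) :
    ∑ x : H, ee (f x) = if ∀ x ∈ H, f x = 0 then (Fintype.card H : ℂ) else 0 := by
  split_ifs with hh
  · rw [Finset.sum_congr rfl (fun x _ => by rw [hh x x.2, ee_zero])]
    simp
  · push Not at hh
    obtain ⟨c, hc, hc0⟩ := hh
    have h1 : ∑ x : H, ee (f x) = ee (f c) * ∑ x : H, ee (f x) := by
      rw [Finset.mul_sum]
      rw [← Equiv.sum_comp (Equiv.addLeft (⟨c, hc⟩ : H))]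
      refine Finset.sum_congr rfl fun x _ => ?_
      simp [hf, ee_add]
    have h2 : ee (f c) ≠ 1 := fun h => hc0 (ee_eq_one h)
    have h3 : (ee (f c) - 1) * ∑ x : H, ee (f x) = 0 := by
      rw [sub_mul, one_mul, ← h1, sub_self]
    rcases mul_eq_zero.1 h3 with h4 | h4
    · exact absurd (sub_eq_zero.1 h4) h2
    · exact h4

/-- Galois conjugation of Gauss sums. -/
lemma galois {X : Type} [Fintype X] (q : X → QZ) (N k a : ℕ) (hN : 0 < N)
    (hq : ∀ x, N • q x = 0) (ha : a.Coprime N) (hs : ∑ x, ee (-(q x)) = k) :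
    ∑ x, ee (-(a • q x)) = k := by
  have hz : IsPrimitiveRoot (Complex.exp (2 * Real.pi * Complex.I / N)) N :=
    Complex.isPrimitiveRoot_exp N hN.ne'
  set z := Complex.exp (2 * Real.pi * Complex.I / N)
  have : NeZero N := ⟨hN.ne'⟩
  have hx : ∀ x, ∃ j : ℕ, z ^ j = ee (-(q x)) := by
    intro x
    obtain ⟨i, -, hi⟩ := hz.eq_pow_of_pow_eq_one (ξ := ee (-(q x)))
      (by rw [← ee_nsmul, smul_neg, hq, neg_zero, ee_zero])
    exact ⟨i, hi⟩
  choose j hj using hx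
  let P : Polynomial ℤ := ∑ x, Polynomial.X ^ (j x) - Polynomial.C (k : ℤ)
  have e1 : Polynomial.aeval z P = 0 := by
    simp only [P, map_sub, map_sum, map_pow, Polynomial.aeval_X, hj, hs]
    simp
  have e2 : minpoly ℤ z ∣ P := minpoly.isIntegrallyClosed_dvd (hz.isIntegral hN) e1
  rw [hz.minpoly_eq_pow_coprime ha] at e2
  have e3 : Polynomial.aeval (z ^ a) P = 0 := by
    obtain ⟨R, hR⟩ := e2
    rw [hR, map_mul, minpoly.aeval, zero_mul]
  simp only [P, map_sub, map_sum, map_pow, Polynomial.aeval_X] at e3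
  have e4 : ∀ x, (z ^ a) ^ (j x) = ee (-(a • q x)) := by
    intro x
    rw [← smul_neg, ee_nsmul, ← hj, ← pow_mul, ← pow_mul, mul_comm]
  simp only [e4] at e3
  simpa [sub_eq_zero] using e3

/-- Gauss sum of a subgroup, twisted by a. -/
noncomputable def GA [Fintype M] (Q : M → QZ) (A : AddSubgroup M) (a : ℤ) : ℂ :=
  ∑ z : A, ee (-(a • Q z))

lemma conv [Fintype M] {Q : M → QZ} (h : IsQM Q) (A : AddSubgroup M) (n a a' : ℤ)
    (hn1 : ∀ x : M, n • x ∈ A) (hn2 : ∀ x ∈ A, n • x = x)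
    (ha : ∀ x ∈ A, (a * a') • x = x) (lam : M → ℂ)
    (hT : ∀ x, lam x ≠ 0 → Q x = 0) (c : ℂ)
    (hS : ∀ v, lam v = c * ∑ w, ee (-(Bf Q v w)) * lam w) (v : M) :
    ∑ z : A, ee (-(a • Q z)) * lam (v + z) = GA Q A a * lam v := by
  have key : ∀ w, lam w ≠ 0 → ∑ z : A, ee (-(a • Q z)) * ee (-(Bf Q z w)) = GA Q A a := by
    intro w hw
    have hu : a' • n • w ∈ A := A.zsmul_mem (hn1 w) a'
    rw [GA]
    symm
    rw [← Equiv.sum_comp (Equiv.addRight (⟨a' • n • w, hu⟩ : A))]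
    symm
    refine Finset.sum_congr rfl fun z _ => ?_
    rw [← ee_add]
    congr 1
    have h1 : Bf Q z w = a • Bf Q z (a' • n • w) := by
      rw [← h.zsr, smul_smul, ha _ (hn1 w), h.zsr, ← h.zsl, hn2 z z.2]
    simp only [Equiv.coe_addRight, AddSubgroup.coe_add]
    rw [Q_add Q, h.Qz _ (h.Qz _ (hT w hw)), h1, add_zero, smul_add]
    abel
  calc ∑ z : A, ee (-(a • Q z)) * lam (v + z)
      = ∑ z : A, ∑ w, c * (ee (-(Bf Q v w)) * lam w *
          (ee (-(a • Q z)) * ee (-(Bf Q z w)))) := by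
        refine Finset.sum_congr rfl fun z _ => ?_
        rw [hS (v + z), Finset.mul_sum, Finset.mul_sum]
        refine Finset.sum_congr rfl fun w _ => ?_
        rw [h.bil, neg_add, ee_add]; ring
    _ = c * ∑ w, ee (-(Bf Q v w)) * lam w *
          ∑ z : A, (ee (-(a • Q z)) * ee (-(Bf Q z w))) := by
        rw [Finset.sum_comm, Finset.mul_sum]
        refine Finset.sum_congr rfl fun w _ => ?_
        rw [Finset.mul_sum, Finset.mul_sum]
    _ = c * ∑ w, ee (-(Bf Q v w)) * lam w * GA Q A a := by
        congr 1
        refine Finset.sum_congr rfl fun w _ => ?_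
        by_cases hw : lam w = 0
        · simp [hw]
        · rw [key w hw]
    _ = GA Q A a * lam v := by
        rw [hS v, ← Finset.sum_mul]; ring

lemma fourA [Fintype M] {Q : M → QZ} (h : IsQM Q) (A : AddSubgroup M) (n a a' : ℤ)
    (hn1 : ∀ x : M, n • x ∈ A) (hn2 : ∀ x ∈ A, n • x = x)
    (ha : ∀ x ∈ A, (a * a') • x = x) (lam : M → ℂ)
    (hT : ∀ x, lam x ≠ 0 → Q x = 0) (c : ℂ)
    (hS : ∀ v, lam v = c * ∑ w, ee (-(Bf Q v w)) * lam w) (y : M) :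
    ∑ x : A, ee (-(a • Bf Q y x)) * lam (y - n • y + x)
      = GA Q A a * lam (y - n • y - n • y) := by
  have hnn : ∀ y : M, n • n • y = n • y := fun y => hn2 _ (hn1 y)
  have h1 : ∑ x : A, ee (-(a • Bf Q y x)) * lam (y - n • y + x)
      = ee (a • Q (n • y)) *
        ∑ z : A, ee (-(a • Q z)) * lam ((y - n • y - n • y) + z) := by
    rw [Finset.mul_sum]
    symm
    rw [← Equiv.sum_comp (Equiv.addRight (⟨n • y, hn1 y⟩ : A))]
    symm
    refine Finset.sum_congr rfl fun x _ => ?_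
    simp only [Equiv.coe_addRight, AddSubgroup.coe_add]
    rw [show y - n • y - n • y + (↑x + n • y) = y - n • y + x by abel]
    by_cases hl : lam (y - n • y + x) = 0
    · simp [hl]
    · have h2 := h.Qz n (hT _ hl)
      rw [smul_add, smul_sub, hnn, sub_self, zero_add, hn2 x x.2] at h2
      rw [← mul_assoc, ← ee_add]
      congr 2
      have e3 : Bf Q x (n • y) = Bf Q y x := by
        rw [h.zsr, ← h.zsl, hn2 x x.2, Bf_symm Q x y]
      rw [Q_add Q, h2, e3, zero_add, smul_add]
      abel
  rw [h1, conv h A n a a' hn1 hn2 ha lam hT c hS]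
  by_cases hl : lam (y - n • y - n • y) = 0
  · simp [hl]
  · have h2 := h.Qz n (hT _ hl)
    rw [smul_sub, smul_sub, hnn, sub_self, zero_sub, h.Qneg] at h2
    rw [h2, smul_zero, ee_zero, one_mul]

lemma scaleA [Fintype M] {Q : M → QZ} (h : IsQM Q) (A : AddSubgroup M) (n a a' : ℤ)
    (hn1 : ∀ x : M, n • x ∈ A) (hn2 : ∀ x ∈ A, n • x = x)
    (ha : ∀ x ∈ A, (a * a') • x = x) (lam : M → ℂ)
    (hT : ∀ x, lam x ≠ 0 → Q x = 0) (c : ℂ)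
    (hS : ∀ v, lam v = c * ∑ w, ee (-(Bf Q v w)) * lam w) (y : M) :
    GA Q A 1 * lam (y - n • y - a • n • y) = GA Q A a * lam (y - n • y - n • y) := by
  have hnn : ∀ y : M, n • n • y = n • y := fun y => hn2 _ (hn1 y)
  rw [← fourA h A n a a' hn1 hn2 ha lam hT c hS y]
  have h1 := fourA h A n 1 1 hn1 hn2 (by simp) lam hT c hS (y - n • y + a • n • y)
  have e1 : n • (y - n • y + a • n • y) = a • n • y := by
    rw [smul_add, smul_sub, hnn, smul_comm n a, hnn]; abel
  rw [e1, show y - n • y + a • n • y - a • n • y - a • n • y = y - n • y - a • n • y by abel,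
    show y - n • y + a • n • y - a • n • y = y - n • y by abel] at h1
  rw [← h1]
  refine Finset.sum_congr rfl fun x _ => ?_
  congr 3
  have e2 : Bf Q (n • y) x = Bf Q y x := by rw [h.zsl, ← h.zsr, hn2 x x.2]
  rw [one_smul, h.bil, h.sl, h.zsl a, e2, sub_self, zero_add]

/-- invariance under the partial Fourier transform -/
lemma partialS [Fintype M] {Q : M → QZ} (h : IsQM Q) (A : AddSubgroup M) (n : ℤ)
    (hn1 : ∀ x : M, n • x ∈ A) (hn2 : ∀ x ∈ A, n • x = x) (lam : M → ℂ)
    (hT : ∀ x, lam x ≠ 0 → Q x = 0) (c : ℂ)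
    (hS : ∀ v, lam v = c * ∑ w, ee (-(Bf Q v w)) * lam w)
    (k : ℕ) (hk1 : GA Q A 1 = k) (y : M) :
    ∑ x : A, ee (-(Bf Q y x)) * lam (y - n • y + x) = k * lam y := by
  have h1 := fourA h A n 1 1 hn1 hn2 (by simp) lam hT c hS y
  simp only [one_smul] at h1
  have h2 := scaleA h A n (-1) (-1) hn1 hn2 (by simp) lam hT c hS y
  have h3 : GA Q A (-1) = k := by
    have : GA Q A (-1) = (starRingEnd ℂ) (GA Q A 1) := by
      rw [GA, GA, map_sum]
      refine Finset.sum_congr rfl fun x _ => ?_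
      simp only [neg_smul, one_smul, neg_neg]
      rw [ee_neg, map_inv₀]
      induction Q x using QuotientAddGroup.induction_on with
      | H t =>
      have := ee_coe t
      rw [show ee (QuotientAddGroup.mk t : QZ) = _ from this, ← Complex.exp_conj,
        ← Complex.exp_neg]
      simp [Complex.conj_ofNat]
    rw [this, hk1]; simp
  rw [h1, hk1]
  rw [h3, hk1] at h2
  rw [← h2]
  congr 2
  simp

lemma sum_coprime_le (p m : ℕ) (hp : p.Prime) (t : QZ) (ht : (p ^ (m + 1)) • t = 0)
    (ht0 : t ≠ 0) :
    (∑ a ∈ (range (p ^ (m + 1))).filter (fun a => a.Coprime p), ee (-(a • t))).re ≤ 0 := by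
  have hz1 : ee (-t) ≠ 1 := fun h => ht0 (neg_eq_zero.1 (ee_eq_one h))
  have hzN : ee (-t) ^ (p ^ (m + 1)) = 1 := by
    rw [← ee_nsmul, smul_neg, ht, neg_zero, ee_zero]
  have e : ∀ a : ℕ, ee (-(a • t)) = ee (-t) ^ a := by
    intro a; rw [← ee_nsmul, smul_neg]
  simp only [e]
  set z := ee (-t)
  have h1 : ∑ a ∈ range (p ^ (m + 1)), z ^ a = 0 := by
    rw [geom_sum_eq hz1, hzN, sub_self, zero_div]
  have h2 := Finset.sum_filter_add_sum_filter_not (range (p ^ (m + 1)))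
    (fun a => a.Coprime p) (fun a => z ^ a)
  rw [h1] at h2
  have h3 : ∑ a ∈ (range (p ^ (m + 1))).filter (fun a => ¬ a.Coprime p), z ^ a
      = ∑ b ∈ range (p ^ m), (z ^ p) ^ b := by
    symm
    refine Finset.sum_bij (fun b _ => p * b) ?_ ?_ ?_ ?_
    · intro b hb
      simp only [Finset.mem_filter, Finset.mem_range] at hb ⊢
      refine ⟨by rw [pow_succ, mul_comm]; exact Nat.mul_lt_mul_of_pos_right hb hp.pos, ?_⟩
      intro hc
      exact hp.one_lt.ne' (Nat.Coprime.eq_one_of_dvd hc.symm (Dvd.intro _ rfl))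
    · intro b _ b' _ hbb
      exact Nat.eq_of_mul_eq_mul_left hp.pos hbb
    · intro a ha
      simp only [Finset.mem_filter, Finset.mem_range] at ha
      have hd : p ∣ a := by
        by_contra hd
        exact ha.2 ((hp.coprime_iff_not_dvd.2 hd).symm)
      obtain ⟨b, rfl⟩ := hd
      refine ⟨b, ?_, rfl⟩
      rw [Finset.mem_range]
      have := ha.1
      rw [pow_succ, mul_comm] at this
      exact lt_of_mul_lt_mul_right this (Nat.zero_le _)
    · intro b _
      rw [pow_mul]
  rw [h3] at h2
  have h4 : 0 ≤ (∑ b ∈ range (p ^ m), (z ^ p) ^ b).re := by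
    by_cases hp1 : z ^ p = 1
    · simp only [hp1, one_pow, Finset.sum_const, Finset.card_range]
      rw [nsmul_eq_mul, mul_one, Complex.natCast_re]
      positivity
    · rw [geom_sum_eq hp1, ← pow_mul, ← pow_succ', hzN]
      simp
  have h5 := congrArg Complex.re h2
  rw [Complex.add_re, Complex.zero_re] at h5
  linarith

/-- The orthogonal complement of `H` inside `A`. -/
def perpA {Q : M → QZ} (h : IsQM Q) (A H : AddSubgroup M) : AddSubgroup M where
  carrier := {y | y ∈ A ∧ ∀ x ∈ H, Bf Q y x = 0}
  zero_mem' := ⟨A.zero_mem, fun x _ => h.zl x⟩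
  add_mem' := by
    rintro a b ⟨ha, ha'⟩ ⟨hb, hb'⟩
    exact ⟨A.add_mem ha hb, fun x hx => by rw [h.bil, ha' x hx, hb' x hx, add_zero]⟩
  neg_mem' := by
    rintro a ⟨ha, ha'⟩
    exact ⟨A.neg_mem ha, fun x hx => by rw [h.nl, ha' x hx, neg_zero]⟩

lemma mem_perpA {Q : M → QZ} (h : IsQM Q) (A H : AddSubgroup M) (y : M) :
    y ∈ perpA h A H ↔ y ∈ A ∧ ∀ x ∈ H, Bf Q y x = 0 := Iff.rfl

lemma card_sub [Fintype M] {A D : AddSubgroup M} (hDA : D ≤ A) (f : M → ℂ) :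
    ∑ x : A, (if (x : M) ∈ D then f x else 0) = ∑ x : D, f x := by
  rw [← Finset.sum_filter]
  symm
  refine Finset.sum_bij (fun x _ => (⟨x, hDA x.2⟩ : A)) ?_ ?_ ?_ ?_
  · intro x _; simp
  · intro x _ y _ hxy; ext; simpa using hxy
  · intro x hx
    simp only [Finset.mem_filter] at hx
    exact ⟨⟨x, hx.2⟩, by simp, rfl⟩
  · intro x _; rfl

lemma card_perp [Fintype M] {Q : M → QZ} (h : IsQM Q) (A H : AddSubgroup M)
    (hHA : H ≤ A) (hA : ∀ x ∈ A, (∀ y ∈ A, Bf Q x y = 0) → x = 0) :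
    Fintype.card H * Fintype.card (perpA h A H) = Fintype.card A := by
  have h1 : ∑ x : A, ∑ c : H, ee (Bf Q x c) = Fintype.card H * Fintype.card (perpA h A H) := by
    have : ∀ x : A, ∑ c : H, ee (Bf Q x c) =
        if (x : M) ∈ perpA h A H then (Fintype.card H : ℂ) else 0 := by
      intro x
      rw [charsum H (fun c => Bf Q x c) (fun a b => h.bilr _ a b)]
      simp [mem_perpA]
    rw [Finset.sum_congr rfl (fun x _ => this x),
      card_sub (A := A) (D := perpA h A H) (fun x hx => hx.1) (fun _ => (Fintype.card H : ℂ))]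
    simp [mul_comm]
  have h2 : ∑ c : H, ∑ x : A, ee (Bf Q x c) = Fintype.card A := by
    rw [Finset.sum_eq_single (0 : H)]
    · simp [h.zr, ee_zero]
    · intro c _ hc
      rw [charsum A (fun x => Bf Q x c) (fun a b => h.bil a b _), if_neg]
      intro hh
      apply hc
      ext
      exact hA c (hHA c.2) (fun y hy => by rw [Bf_symm]; exact hh y hy)
    · simp
  rw [Finset.sum_comm, h2] at h1
  exact_mod_cast h1.symm

lemma GA_perp [Fintype M] {Q : M → QZ} (h : IsQM Q) (A H : AddSubgroup M)
    (hHA : H ≤ A) (hH : ∀ x ∈ H, Q x = 0) (a a' : ℤ) (ha : ∀ x ∈ A, (a * a') • x = x) :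
    GA Q A a = ∑ x : perpA h A H, ee (-(a • Q x)) := by
  have h0 : (Fintype.card H : ℂ) ≠ 0 := by exact_mod_cast Fintype.card_ne_zero
  apply mul_left_cancel₀ h0
  have h1 : ∀ c : H, GA Q A a = ∑ x : A, ee (-(a • Q x)) * ee (-(a • Bf Q x c)) := by
    intro c
    rw [GA, ← Equiv.sum_comp (Equiv.addRight (⟨c, hHA c.2⟩ : A))]
    refine Finset.sum_congr rfl fun x _ => ?_
    simp only [Equiv.coe_addRight, AddSubgroup.coe_add]
    rw [Q_add Q, hH c c.2, ← ee_add, add_zero, smul_add, neg_add]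
  calc (Fintype.card H : ℂ) * GA Q A a = ∑ c : H, GA Q A a := by simp
    _ = ∑ x : A, ee (-(a • Q x)) * ∑ c : H, ee (-(a • Bf Q x c)) := by
      rw [Finset.sum_congr rfl (fun c _ => h1 c), Finset.sum_comm]
      simp_rw [Finset.mul_sum]
    _ = ∑ x : A, (if (x : M) ∈ perpA h A H then
          (Fintype.card H : ℂ) * ee (-(a • Q x)) else 0) := by
      refine Finset.sum_congr rfl fun x _ => ?_
      rw [charsum H (fun c => -(a • Bf Q x c))
        (fun u v => by simp only [h.bilr, smul_add, neg_add])]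
      have : (∀ c ∈ H, -(a • Bf Q x c) = 0) ↔ (x : M) ∈ perpA h A H := by
        rw [mem_perpA]
        constructor
        · intro hh
          refine ⟨x.2, fun c hc => ?_⟩
          have := hh (a' • c) (H.zsmul_mem hc a')
          rwa [← h.zsr, smul_smul, ha c (hHA hc), neg_eq_zero] at this
        · intro hh c hc
          rw [hh.2 c hc, smul_zero, neg_zero]
      simp only [this]
      split_ifs
      · ring
      · ring
    _ = _ := by
      rw [card_sub (A := A) (D := perpA h A H) (fun x hx => hx.1)
        (fun x => (Fintype.card H : ℂ) * ee (-(a • Q x))), Finset.mul_sum]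

/-- existence of isotropic vectors -/
lemma exists_iso [Fintype M] {Q : M → QZ} (h : IsQM Q) (A H : AddSubgroup M)
    (hHA : H ≤ A) (hH : ∀ x ∈ H, Q x = 0) (hA : ∀ x ∈ A, (∀ y ∈ A, Bf Q x y = 0) → x = 0)
    (p j k : ℕ) (hp : p.Prime) (hpj : ∀ x ∈ A, (p ^ j) • x = 0)
    (hcard : Fintype.card A = k ^ 2) (hG : GA Q A 1 = k)
    (y : M) (hy : y ∈ perpA h A H) (hyH : y ∉ H) :
    ∃ y ∈ perpA h A H, Q y = 0 ∧ y ∉ H := by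
  by_contra hcon
  push Not at hcon
  set D := perpA h A H with hD
  have hHD : H ≤ D := by
    intro x hx
    refine ⟨hHA hx, fun c hc => ?_⟩
    unfold Bf
    rw [hH _ (H.add_mem hx hc), hH x hx, hH c hc]; simp
  set m := 2 * j
  have hN : ∀ x ∈ A, (p ^ (m + 1)) • Q x = 0 := by
    intro x hx
    have h1 := h.quad ((p ^ j : ℕ) : ℤ) x
    rw [natCast_zsmul, hpj x hx, h.Q0] at h1
    have h2 : (p ^ m) • Q x = 0 := by
      rw [h1, ← natCast_zsmul]; congr 1; simp only [m]; push_cast; ring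
    rw [pow_succ, mul_comm, mul_smul, h2, smul_zero]
  set U := (range (p ^ (m + 1))).filter (fun a => a.Coprime p) with hU
  have hUpos : 0 < U.card := by
    apply Finset.card_pos.2
    refine ⟨1, ?_⟩
    simp only [hU, Finset.mem_filter, Finset.mem_range]
    exact ⟨Nat.one_lt_pow (by omega) hp.one_lt, by simp⟩
  have hGa : ∀ a ∈ U, ∑ x : D, ee (-(a • Q x)) = k := by
    intro a ha
    have hac : a.Coprime p := (Finset.mem_filter.1 ha).2
    have hg := galois (fun x : A => Q x) (p ^ (m + 1)) k a (pow_pos hp.pos _)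
      (fun x => hN x x.2) (Nat.Coprime.pow_right _ hac) (by simpa [GA] using hG)
    have hac2 : IsCoprime (a : ℤ) ((p ^ j : ℕ) : ℤ) :=
      Nat.isCoprime_iff_coprime.2 (Nat.Coprime.pow_right _ hac)
    obtain ⟨u, v, huv⟩ := hac2
    have h3 := GA_perp h A H hHA hH a u (by
      intro x hx
      have : (a : ℤ) * u = 1 - v * ((p ^ j : ℕ) : ℤ) := by linarith
      rw [this, sub_smul, mul_smul, natCast_zsmul, hpj x hx, smul_zero, sub_zero, one_smul])
    simp only [natCast_zsmul, GA] at h3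
    rw [← h3, hg]
  have h4 : (U.card : ℝ) * k ≤ U.card * Fintype.card H := by
    have e1 : (∑ a ∈ U, ∑ x : D, ee (-(a • Q x))).re = U.card * k := by
      rw [Finset.sum_congr rfl hGa]; simp
    rw [← e1, Finset.sum_comm, Complex.re_sum]
    calc ∑ x : D, (∑ a ∈ U, ee (-(a • Q x))).re
        ≤ ∑ x : D, (if (x : M) ∈ H then (U.card : ℝ) else 0) := by
          refine Finset.sum_le_sum fun x _ => ?_
          split_ifs with hx
          · simp [hH x hx, ee_zero]
          · exact sum_coprime_le p m hp (Q x) (hN x x.2.1) (fun hq => hx (hcon x x.2 hq))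
      _ = U.card * Fintype.card H := by
          have := card_sub hHD (fun _ => (U.card : ℂ))
          have h5 : ((∑ x : D, (if (x : M) ∈ H then (U.card : ℝ) else 0) : ℝ) : ℂ)
            = ((U.card * Fintype.card H : ℝ) : ℂ) := by
            rw [Complex.ofReal_sum]
            refine Eq.trans (Finset.sum_congr rfl fun x _ => ?_) (this.trans ?_)
            · split_ifs <;> simp
            · simp [mul_comm]
          exact_mod_cast h5
  have h6 : k ≤ Fintype.card H := by
    have : (k : ℝ) ≤ Fintype.card H := le_of_mul_le_mul_left h4 (by exact_mod_cast hUpos)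
    exact_mod_cast this
  have h7 := card_perp h A H hHA hA
  rw [hcard, ← hD] at h7
  have hlt : Fintype.card H < Fintype.card D := by
    refine Fintype.card_lt_of_injective_of_notMem (fun x : H => (⟨x, hHD x.2⟩ : D))
      ?_ (b := ⟨y, hy⟩) ?_
    · intro a b hab; ext; simpa using hab
    · rintro ⟨x, hx⟩
      apply hyH
      have := congrArg Subtype.val hx
      simp only at this
      rw [← this]; exact x.2
  have : k ^ 2 < Fintype.card H * Fintype.card D := by
    rcases Nat.eq_zero_or_pos (Fintype.card H) with h0 | h0
    · exact absurd h0 Fintype.card_ne_zero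
    · nlinarith
  omega

/-- structure of primary components -/
lemma pc_facts [Fintype M] (p : ℕ) (hp : p.Prime) :
    ∃ (j : ℕ) (n : ℤ), (∀ x ∈ primaryComp M p, (p ^ j) • x = 0) ∧
      (∀ x : M, n • x ∈ primaryComp M p) ∧ (∀ x ∈ primaryComp M p, n • x = x) ∧
      (p ∣ Fintype.card M → ¬ (p : ℤ) ∣ n) ∧
      ((∃ k, Fintype.card M = k ^ 2) → ∃ k, Fintype.card (primaryComp M p) = k ^ 2) := by
  set A := primaryComp M p with hA
  have hpf : Fact p.Prime := ⟨hp⟩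
  have hAp : ∃ j, Nat.card A = p ^ j := by
    have : IsPGroup p (Multiplicative A) := by
      intro x
      obtain ⟨k, hk⟩ := (Multiplicative.toAdd x).2
      refine ⟨k, ?_⟩
      apply Multiplicative.toAdd.injective
      ext
      simpa using hk
    obtain ⟨j, hj⟩ := IsPGroup.iff_card.1 this
    exact ⟨j, by simpa using hj⟩
  obtain ⟨j, hj⟩ := hAp
  have hpj : ∀ x ∈ A, (p ^ j) • x = 0 := by
    intro x hx
    have := card_nsmul_eq_zero' (x := (⟨x, hx⟩ : A))
    rw [hj] at this
    simpa using congrArg Subtype.val this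
  have hcard : Nat.card M = Nat.card (M ⧸ A) * Nat.card A :=
    AddSubgroup.card_eq_card_quotient_mul_card_addSubgroup A
  have hnp : ¬ p ∣ Nat.card (M ⧸ A) := by
    intro hd
    obtain ⟨x, hx⟩ := exists_prime_addOrderOf_dvd_card' p hd
    induction x using QuotientAddGroup.induction_on with
    | H x =>
    have h1 : p • (x : M ⧸ A) = 0 := by rw [← hx]; exact addOrderOf_nsmul_eq_zero _
    have h2 : p • x ∈ A := by
      rw [← QuotientAddGroup.eq_zero_iff]; simpa using h1
    obtain ⟨k, hk⟩ := h2
    have h3 : x ∈ A := ⟨k + 1, by rw [pow_succ, mul_smul, hk]⟩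
    rw [(QuotientAddGroup.eq_zero_iff x).2 h3, addOrderOf_zero] at hx
    exact hp.one_lt.ne hx
  set m := Nat.card (M ⧸ A)
  have hco : Nat.Coprime (p ^ j) m := Nat.Coprime.pow_left _ (hp.coprime_iff_not_dvd.2 hnp)
  obtain ⟨n, hn1, hn2⟩ := Nat.chineseRemainder hco 1 0
  have hd : m ∣ n := (Nat.modEq_zero_iff_dvd).1 hn2
  refine ⟨j, n, hpj, ?_, ?_, ?_, ?_⟩
  · intro x
    refine ⟨j, ?_⟩
    obtain ⟨r, rfl⟩ := hd
    rw [natCast_zsmul, smul_smul, ← mul_assoc, mul_comm (p ^ j) m, ← hj, ← hcard, mul_comm,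
      mul_smul, card_nsmul_eq_zero', smul_zero]
  · intro x hx
    rw [natCast_zsmul]
    have h1 : (n : ℤ) ≡ 1 [ZMOD ((p ^ j : ℕ) : ℤ)] := by
      exact_mod_cast (Int.natCast_modEq_iff.2 hn1)
    obtain ⟨r, hr⟩ := h1.symm.dvd
    have h2 : (n : ℤ) = 1 + r * ((p ^ j : ℕ) : ℤ) := by linarith
    rw [← natCast_zsmul, h2, add_smul, mul_smul, natCast_zsmul, hpj x hx, smul_zero, one_smul,
      add_zero]
  · intro hpc hpn
    rw [← Nat.card_eq_fintype_card, hcard] at hpc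
    have h1 : p ∣ p ^ j := by
      rw [← hj]; exact (hp.dvd_mul.1 hpc).resolve_left hnp
    have h2 : n ≡ 1 [MOD p] := hn1.of_dvd h1
    have h3 : p ∣ n := by exact_mod_cast hpn
    have h4 : 0 ≡ 1 [MOD p] := ((Nat.modEq_zero_iff_dvd.2 h3).symm).trans h2
    have := (Nat.modEq_zero_iff_dvd.1 h4.symm)
    exact hp.one_lt.ne' (Nat.dvd_one.1 this)
  · rintro ⟨k, hk⟩
    rw [← Nat.card_eq_fintype_card, hcard, hj] at hk
    rw [← Nat.card_eq_fintype_card, hj]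
    obtain ⟨d, hd⟩ := exists_associated_pow_of_mul_eq_pow
      (Nat.isUnit_iff.2 (hco : Nat.gcd (p^j) m = 1)) (by rw [mul_comm]; exact hk)
    exact ⟨d, (associated_iff_eq.1 hd).symm⟩

/-- isotropic -/
def Iso (Q : M → QZ) (C : AddSubgroup M) : Prop := ∀ x ∈ C, Q x = 0

/-- self-dual -/
def SD (Q : M → QZ) (C : AddSubgroup M) : Prop :=
  ∀ y : M, y ∈ C ↔ ∀ x ∈ C, Bf Q x y = 0

/-- indicator function -/
noncomputable def Ind (C : AddSubgroup M) : M → ℂ := (C : Set M).indicator 1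

lemma Ind_apply (C : AddSubgroup M) (x : M) : Ind C x = if x ∈ C then 1 else 0 := by
  simp [Ind, Set.indicator_apply]

/-- local data at a prime -/
structure IsPD [Fintype M] (Q : M → QZ) (A : AddSubgroup M) (p j k : ℕ) (n : ℤ) : Prop where
  hp : p.Prime
  hpj : ∀ x ∈ A, (p ^ j) • x = 0
  n1 : ∀ x : M, n • x ∈ A
  n2 : ∀ x ∈ A, n • x = x
  card : Fintype.card A = k ^ 2
  G : GA Q A 1 = k

/-- all local data -/
def AllPD [Fintype M] (Q : M → QZ) : Prop :=
  ∀ p : ℕ, p.Prime → ∃ (j k : ℕ) (n : ℤ), IsPD Q (primaryComp M p) p j k n ∧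
    (p ∣ Fintype.card M → ¬ (p : ℤ) ∣ n)

lemma allPD [Fintype M] (Q : M → QZ) (hsq : ∃ k : ℕ, Nat.card M = k ^ 2)
    (hsig : ∀ p : ℕ, p.Prime →
      gaussSigma (fun x : primaryComp M p => Q (x : M)) = 1) : AllPD Q := by
  intro p hp
  obtain ⟨j, n, h1, h2, h3, h4, h5⟩ := pc_facts (M := M) p hp
  rw [Nat.card_eq_fintype_card] at hsq
  obtain ⟨k, hk⟩ := h5 hsq
  refine ⟨j, k, n, ⟨hp, h1, h2, h3, hk, ?_⟩, h4⟩
  have h6 := hsig p hp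
  unfold gaussSigma at h6
  rw [finsum_eq_sum_of_fintype, Nat.card_eq_fintype_card, hk] at h6
  have h7 : Real.sqrt ((k ^ 2 : ℕ) : ℝ) = k := by
    push_cast; exact Real.sqrt_sq (by positivity)
  rw [h7] at h6
  have h8 : (k : ℂ) ≠ 0 := by
    rintro h0
    simp [h0] at h6
  rw [Complex.ofReal_natCast, inv_mul_eq_one₀ h8] at h6
  simp only [GA, one_smul]
  exact h6.symm

lemma Iso.orth {Q : M → QZ} {C : AddSubgroup M} (hC : Iso Q C) {x y : M} (hx : x ∈ C)
    (hy : y ∈ C) : Bf Q x y = 0 := by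
  unfold Bf
  rw [hC _ (C.add_mem hx hy), hC x hx, hC y hy]; simp

lemma exists_local [Fintype M] {Q : M → QZ} (h : IsQM Q) (hP : AllPD Q) {C : AddSubgroup M}
    (hC : Iso Q C) (hSD : ¬ SD Q C) :
    ∃ p : ℕ, p.Prime ∧ ∃ y ∈ primaryComp M p, Q y = 0 ∧ (∀ c ∈ C, Bf Q y c = 0) ∧ y ∉ C := by
  have : ∃ y, (∀ x ∈ C, Bf Q x y = 0) ∧ y ∉ C := by
    by_contra hcon
    push Not at hcon
    exact hSD fun y => ⟨fun hy x hx => hC.orth hx hy, hcon y⟩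
  obtain ⟨y, hy, hyC⟩ := this
  set d := addOrderOf (y : M ⧸ C) with hd
  have hd1 : d ≠ 1 := by
    intro h1
    rw [hd, AddMonoid.addOrderOf_eq_one_iff] at h1
    exact hyC ((QuotientAddGroup.eq_zero_iff y).1 h1)
  have hp := Nat.minFac_prime hd1
  set p := d.minFac
  have hpd : p ∣ d := Nat.minFac_dvd d
  have hpM : p ∣ Fintype.card M := by
    refine hpd.trans ((addOrderOf_dvd_natCard _).trans ?_)
    rw [← Nat.card_eq_fintype_card]
    exact AddSubgroup.card_quotient_dvd_card C
  obtain ⟨j, k, n, D, hn⟩ := hP p hp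
  refine ⟨p, hp, ?_⟩
  set A := primaryComp M p
  have hnd : ∀ x ∈ A, (∀ y ∈ A, Bf Q x y = 0) → x = 0 := by
    intro x hx hxy
    refine h.nd x fun y => ?_
    rw [← D.n2 x hx, h.zsl, ← h.zsr]
    exact hxy _ (D.n1 y)
  have hny : n • y ∉ C := by
    intro hny
    apply hn hpM
    have h1 : n • (y : M ⧸ C) = 0 := by
      rw [← QuotientAddGroup.mk_zsmul]; exact (QuotientAddGroup.eq_zero_iff _).2 hny
    exact (Int.natCast_dvd_natCast.2 hpd).trans (addOrderOf_dvd_iff_zsmul_eq_zero.2 h1)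
  obtain ⟨z, hz, hz0, hzC⟩ := exists_iso h A (C ⊓ A) inf_le_right (fun x hx => hC x hx.1) hnd
    p j k hp D.hpj D.card D.G (n • y)
    ⟨D.n1 y, fun x hx => by rw [Bf_symm, h.zsr, hy x hx.1, smul_zero]⟩ (fun hh => hny hh.1)
  refine ⟨z, hz.1, hz0, fun c hc => ?_, fun hh => hzC ⟨hh, hz.1⟩⟩
  rw [← D.n2 z hz.1, h.zsl, ← h.zsr]
  exact hz.2 _ ⟨C.zsmul_mem hc n, D.n1 c⟩

lemma Iso.sup {Q : M → QZ} (h : IsQM Q) {C : AddSubgroup M} (hC : Iso Q C) {y : M}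
    (hy : Q y = 0) (hyC : ∀ c ∈ C, Bf Q y c = 0) : Iso Q (C ⊔ AddSubgroup.zmultiples y) := by
  intro x hx
  obtain ⟨c, hc, z, hz, rfl⟩ := AddSubgroup.mem_sup.1 hx
  obtain ⟨i, rfl⟩ := AddSubgroup.mem_zmultiples_iff.1 hz
  rw [Q_add Q, hC c hc, h.Qz i hy, h.zsr, Bf_symm, hyC c hc]; simp

lemma exists_SD [Fintype M] {Q : M → QZ} (h : IsQM Q) (hP : AllPD Q) :
    ∃ U : AddSubgroup M, Iso Q U ∧ SD Q U := by
  obtain ⟨U, hU⟩ := Set.Finite.exists_maximal (Set.toFinite {C : AddSubgroup M | Iso Q C})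
    ⟨⊥, by intro x hx; rw [AddSubgroup.mem_bot.1 hx, h.Q0]⟩
  refine ⟨U, hU.1, ?_⟩
  by_contra hSD
  obtain ⟨p, hp, y, -, hy0, hyC, hy⟩ := exists_local h hP hU.1 hSD
  have := hU.2 (Iso.sup h hU.1 hy0 hyC) le_sup_left
  exact hy (this (AddSubgroup.mem_sup_right (AddSubgroup.mem_zmultiples y)))

lemma SD_perp [Fintype M] {Q : M → QZ} (h : IsQM Q) {U : AddSubgroup M} (hU : SD Q U) :
    perpA h ⊤ U = U := by
  ext y
  rw [mem_perpA, hU y]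
  simp only [AddSubgroup.mem_top, true_and]
  exact forall₂_congr fun x _ => by rw [Bf_symm]

lemma SD_gauss [Fintype M] {Q : M → QZ} (h : IsQM Q) {U : AddSubgroup M} (hI : Iso Q U)
    (hU : SD Q U) : GA Q ⊤ 1 = Fintype.card U ∧ Fintype.card M = Fintype.card U ^ 2 := by
  constructor
  · rw [GA_perp h ⊤ U le_top hI 1 1 (by simp)]
    rw [SD_perp h hU]
    rw [Finset.sum_congr rfl (fun (x : U) _ => by rw [hI x x.2, smul_zero, neg_zero, ee_zero])]
    simp
  · have := card_perp h ⊤ U le_top (fun x _ hx => h.nd x fun y => hx y trivial)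
    rw [SD_perp h hU] at this
    rw [sq, this, Fintype.card_congr (AddSubgroup.topEquiv (G := M)).toEquiv]

lemma gs_eq [Fintype M] (Q : M → QZ) : ∑ᶠ x : M, ee (-(Q x)) = GA Q ⊤ 1 := by
  rw [finsum_eq_sum_of_fintype, GA, ← Equiv.sum_comp (AddSubgroup.topEquiv (G := M)).toEquiv]
  simp

lemma SD_inv [Fintype M] {Q : M → QZ} (h : IsQM Q) {U : AddSubgroup M} (hI : Iso Q U)
    (hU : SD Q U) : Tweil Q (Ind U) = Ind U ∧ Sweil Q (Ind U) = Ind U := by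
  obtain ⟨h1, h2⟩ := SD_gauss h hI hU
  constructor
  · ext x
    rw [Tweil, Ind_apply]
    split_ifs with hx
    · rw [hI x hx, ee_zero, mul_one]
    · simp
  · ext y
    rw [Sweil, gaussSigma, gs_eq, h1, Nat.card_eq_fintype_card, h2]
    have h7 : Real.sqrt ((Fintype.card U ^ 2 : ℕ) : ℝ) = Fintype.card U := by
      push_cast; exact Real.sqrt_sq (by positivity)
    have h0 : (Fintype.card U : ℂ) ≠ 0 := by exact_mod_cast Fintype.card_ne_zero
    rw [h7, Complex.ofReal_natCast, inv_mul_cancel₀ h0, one_mul, finsum_eq_sum_of_fintype]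
    have h3 : ∑ x : M, ee (-(Bf Q y x)) * Ind U x = ∑ x : U, ee (-(Bf Q y x)) := by
      rw [← card_sub (A := ⊤) (D := U) le_top (fun x => ee (-(Bf Q y x))),
        ← Equiv.sum_comp (AddSubgroup.topEquiv (G := M)).toEquiv]
      refine Finset.sum_congr rfl fun x _ => ?_
      simp [Ind_apply]
    rw [h3, charsum U (fun x => -(Bf Q y x)) (fun a b => by rw [h.bilr, neg_add]), Ind_apply]
    have h4 : (∀ x ∈ U, -(Bf Q y x) = 0) ↔ y ∈ U := by
      rw [hU y]
      exact forall₂_congr fun x _ => by rw [Bf_symm, neg_eq_zero]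
    simp only [h4]
    split_ifs
    · exact inv_mul_cancel₀ h0
    · simp

lemma inv_T {Q : M → QZ} {lam : M → ℂ} (hT : Tweil Q lam = lam) (x : M) (hx : lam x ≠ 0) :
    Q x = 0 := by
  have := congrFun hT x
  rw [Tweil] at this
  exact ee_eq_one (mul_right_cancel₀ hx (by rw [this, one_mul]))

lemma unit_inv [Fintype M] {Q : M → QZ} (h : IsQM Q) {u : ℕ} (hu : u ≠ 0)
    (hG : GA Q ⊤ 1 = u) (lam : M → ℂ)
    (hT : ∀ x, lam x ≠ 0 → Q x = 0) (c : ℂ)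
    (hS : ∀ v, lam v = c * ∑ w, ee (-(Bf Q v w)) * lam w) (a : ℕ)
    (ha : a.Coprime (Fintype.card M)) (y : M) : lam (a • y) = lam y := by
  have hcz : ∀ x : M, Fintype.card M • x = 0 := fun x => card_nsmul_eq_zero
  have hN : ∀ x : M, (Fintype.card M ^ 2) • Q x = 0 := by
    intro x
    have := h.quad (Fintype.card M : ℤ) x
    rw [natCast_zsmul, hcz, h.Q0] at this
    rw [this, ← natCast_zsmul]; congr 1
  obtain ⟨s, t, hst⟩ := Nat.isCoprime_iff_coprime.2 ha
  have hg := galois (fun x : (⊤ : AddSubgroup M) => Q x) (Fintype.card M ^ 2) u a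
    (pow_pos Fintype.card_pos _) (fun x => hN x) (Nat.Coprime.pow_right _ ha)
    (by simpa [GA] using hG)
  have h1 := scaleA h ⊤ 1 a s (by simp) (by simp) (by
    intro x _
    have : (a : ℤ) * s = 1 - t * (Fintype.card M : ℤ) := by linarith
    rw [this, sub_smul, mul_smul, natCast_zsmul, hcz, smul_zero, sub_zero, one_smul])
    lam hT c hS (-y)
  have h2 : GA Q ⊤ (a : ℤ) = u := by simpa [GA] using hg
  rw [h2, hG] at h1
  have h3 := mul_left_cancel₀ (by exact_mod_cast hu) h1
  simpa using h3

lemma gen_inv [Fintype M] (lam : M → ℂ)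
    (hl : ∀ a : ℕ, a.Coprime (Fintype.card M) → ∀ y, lam (a • y) = lam y) (x x' : M)
    (hx : AddSubgroup.zmultiples x = AddSubgroup.zmultiples x') : lam x = lam x' := by
  have h1 : x' ∈ AddSubmonoid.multiples x := by
    rw [mem_multiples_iff_mem_zmultiples, hx]; exact AddSubgroup.mem_zmultiples x'
  obtain ⟨a, ha⟩ := AddSubmonoid.mem_multiples_iff _ _ |>.1 h1
  have h2 : addOrderOf x' = addOrderOf x := by
    rw [← Nat.card_zmultiples, ← Nat.card_zmultiples, hx]
  have hpos : 0 < addOrderOf x := addOrderOf_pos x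
  have hco : a.Coprime (addOrderOf x) := by
    rw [← ha, addOrderOf_nsmul] at h2
    have h3 : (addOrderOf x).gcd a ∣ addOrderOf x := Nat.gcd_dvd_left _ _
    have h4 := Nat.div_mul_cancel h3
    rw [h2] at h4
    have h5 : (addOrderOf x).gcd a = 1 := by
      have : addOrderOf x * (addOrderOf x).gcd a = addOrderOf x * 1 := by omega
      exact Nat.eq_of_mul_eq_mul_left hpos this
    rw [Nat.coprime_comm]; exact h5
  have hd : addOrderOf x ∣ Fintype.card M := addOrderOf_dvd_card
  have : NeZero (Fintype.card M) := ⟨Fintype.card_ne_zero⟩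
  obtain ⟨w, hw⟩ := ZMod.unitsMap_surjective hd (ZMod.unitOfCoprime a hco)
  have h6 := ZMod.val_coe_unit_coprime w
  rw [← hl _ h6 x, ← ha]
  congr 1
  rw [nsmul_eq_nsmul_iff_modEq]
  have h7 := congrArg Units.val hw
  rw [ZMod.unitsMap_val, ZMod.coe_unitOfCoprime] at h7
  rw [← ZMod.natCast_eq_natCast_iff, ← h7]
  rw [ZMod.natCast_val]

lemma gen_span [Fintype M] {Q : M → QZ} (h : IsQM Q) (C : AddSubgroup M) (hC : Iso Q C) :
    (fun x => if AddSubgroup.zmultiples x = C then (1 : ℂ) else 0) ∈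
      Submodule.span ℂ (Ind '' {C : AddSubgroup M | Iso Q C}) := by
  induction C using WellFoundedLT.induction with
  | ind C ih =>
  have h1 : (fun x => if AddSubgroup.zmultiples x = C then (1 : ℂ) else 0) =
      Ind C - ∑ D ∈ univ.filter (fun D : AddSubgroup M => D < C),
        (fun x => if AddSubgroup.zmultiples x = D then (1 : ℂ) else 0) := by
    ext x
    simp only [Pi.sub_apply, Finset.sum_apply, Ind_apply, Finset.sum_ite_eq, Finset.mem_filter,
      Finset.mem_univ, true_and]
    rcases eq_or_ne (AddSubgroup.zmultiples x) C with he | he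
    · subst he; simp
    · have : AddSubgroup.zmultiples x < C ↔ x ∈ C := by
        rw [lt_iff_le_and_ne, AddSubgroup.zmultiples_le]
        exact ⟨fun hh => hh.1, fun hh => ⟨hh, he⟩⟩
      simp [he, this]
  rw [h1]
  refine Submodule.sub_mem _ (Submodule.subset_span ⟨C, hC, rfl⟩) (Submodule.sum_mem _ ?_)
  intro D hD
  have hD := (Finset.mem_filter.1 hD).2
  exact ih D hD (fun x hx => hC x (hD.le hx))

lemma inv_span [Fintype M] {Q : M → QZ} (h : IsQM Q) (lam : M → ℂ)
    (hT : ∀ x, lam x ≠ 0 → Q x = 0)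
    (hg : ∀ x x' : M, AddSubgroup.zmultiples x = AddSubgroup.zmultiples x' → lam x = lam x') :
    lam ∈ Submodule.span ℂ (Ind '' {C : AddSubgroup M | Iso Q C}) := by
  have hv : ∃ v : AddSubgroup M → ℂ, ∀ x, v (AddSubgroup.zmultiples x) = lam x := by
    refine ⟨fun C => if hh : ∃ x, AddSubgroup.zmultiples x = C then lam hh.choose else 0, ?_⟩
    intro x
    have hh : ∃ x', AddSubgroup.zmultiples x' = AddSubgroup.zmultiples x := ⟨x, rfl⟩
    simp only [dif_pos hh]
    exact hg _ _ hh.choose_spec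
  obtain ⟨v, hv⟩ := hv
  have h1 : lam = ∑ D ∈ univ.filter (fun D : AddSubgroup M => Iso Q D),
      v D • (fun x => if AddSubgroup.zmultiples x = D then (1 : ℂ) else 0) := by
    ext x
    simp only [Finset.sum_apply, Pi.smul_apply, smul_eq_mul, mul_ite, mul_one, mul_zero,
      Finset.sum_ite_eq, Finset.mem_filter, Finset.mem_univ, true_and, hv]
    split_ifs with hh
    · rfl
    · by_contra hx
      apply hh
      intro z hz
      obtain ⟨i, rfl⟩ := AddSubgroup.mem_zmultiples_iff.1 hz
      exact h.Qz i (hT x hx)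
  rw [h1]
  refine Submodule.sum_mem _ fun D hD => Submodule.smul_mem _ _ ?_
  exact gen_span h D (Finset.mem_filter.1 hD).2

/-- the operator `E_T ∘ S` at a prime -/
noncomputable def Xop [Fintype M] (Q : M → QZ) (A : AddSubgroup M) (n : ℤ) (k : ℕ) :
    (M → ℂ) →ₗ[ℂ] (M → ℂ) where
  toFun f := fun y => if Q y = 0 then
    (k : ℂ)⁻¹ * ∑ x : A, ee (-(Bf Q y x)) * f (y - n • y + x) else 0
  map_add' f g := by
    ext y
    simp only [Pi.add_apply]
    split_ifs
    · rw [← mul_add, ← Finset.sum_add_distrib]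
      simp only [mul_add]
    · simp
  map_smul' c f := by
    ext y
    simp only [Pi.smul_apply, smul_eq_mul, RingHom.id_apply]
    split_ifs
    · rw [Finset.mul_sum, Finset.mul_sum, Finset.mul_sum]
      refine Finset.sum_congr rfl fun x _ => ?_
      ring
    · simp

lemma Xop_apply [Fintype M] (Q : M → QZ) (A : AddSubgroup M) (n : ℤ) (k : ℕ) (f : M → ℂ)
    (y : M) : Xop Q A n k f y = if Q y = 0 then
    (k : ℂ)⁻¹ * ∑ x : A, ee (-(Bf Q y x)) * f (y - n • y + x) else 0 := rfl

lemma IsPD.k0 [Fintype M] {Q : M → QZ} {A : AddSubgroup M} {p j k : ℕ} {n : ℤ}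
    (D : IsPD Q A p j k n) : (k : ℂ) ≠ 0 := by
  have h1 := D.card
  have h2 : Fintype.card A ≠ 0 := Fintype.card_ne_zero
  intro h3
  have h4 : k = 0 := by exact_mod_cast h3
  rw [h4] at h1
  exact h2 (by simpa using h1)

lemma Xop_inv [Fintype M] {Q : M → QZ} (h : IsQM Q) {A : AddSubgroup M} {p j k : ℕ} {n : ℤ}
    (D : IsPD Q A p j k n) (lam : M → ℂ)
    (hT : ∀ x, lam x ≠ 0 → Q x = 0) (c : ℂ)
    (hS : ∀ v, lam v = c * ∑ w, ee (-(Bf Q v w)) * lam w) : Xop Q A n k lam = lam := by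
  ext y
  rw [Xop_apply, partialS h A n D.n1 D.n2 lam hT c hS k D.G y]
  split_ifs with hy
  · rw [← mul_assoc, inv_mul_cancel₀ D.k0, one_mul]
  · by_contra hh
    exact hy (hT y (fun h0 => hh h0.symm))

/-- the set of isotropic vectors orthogonal to `C`, with `p'`-part in `C` -/
def Zp (Q : M → QZ) (C : AddSubgroup M) (n : ℤ) (y : M) : Prop :=
  (∀ c ∈ C, Bf Q y c = 0) ∧ y - n • y ∈ C ∧ Q y = 0

lemma Xop_Ind [Fintype M] {Q : M → QZ} (h : IsQM Q) {A : AddSubgroup M} {p j k : ℕ} {n : ℤ}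
    (D : IsPD Q A p j k n) {C : AddSubgroup M} (hC : Iso Q C) :
    Xop Q A n k (Ind C) = ((Fintype.card (C ⊓ A : AddSubgroup M) / k : ℝ) : ℂ) •
      (fun y => if Zp Q C n y then (1 : ℂ) else 0) := by
  ext y
  rw [Xop_apply]
  simp only [Pi.smul_apply, smul_eq_mul, mul_ite, mul_one, mul_zero]
  by_cases hy0 : Q y = 0
  swap
  · rw [if_neg hy0, if_neg (fun hz => hy0 hz.2.2)]
  rw [if_pos hy0]
  have hnn : ∀ y : M, n • n • y = n • y := fun y => D.n2 _ (D.n1 y)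
  by_cases hyC : y - n • y ∈ C
  · have h1 : ∑ x : A, ee (-(Bf Q y x)) * Ind C (y - n • y + x) =
        ∑ x : A, (if (x : M) ∈ C ⊓ A then ee (-(Bf Q y x)) else 0) := by
      refine Finset.sum_congr rfl fun x _ => ?_
      rw [Ind_apply, AddSubgroup.add_mem_cancel_left C hyC]
      simp [AddSubgroup.mem_inf]
    rw [h1, card_sub (A := A) (D := C ⊓ A) inf_le_right (fun x => ee (-(Bf Q y x))),
      charsum (C ⊓ A) (fun x => -(Bf Q y x)) (fun a b => by rw [h.bilr, neg_add])]
    have h2 : (∀ x ∈ C ⊓ A, -(Bf Q y x) = 0) ↔ Zp Q C n y := by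
      constructor
      · intro hh
        refine ⟨fun c hc => ?_, hyC, hy0⟩
        have e1 := hC.orth hyC hc
        have e2 := hh (n • c) ⟨C.zsmul_mem hc n, D.n1 c⟩
        rw [h.sl, h.zsl, ← h.zsr, neg_eq_zero.1 e2, sub_zero] at e1
        exact e1
      · intro hh x hx
        rw [hh.1 x hx.1, neg_zero]
    simp only [h2]
    split_ifs
    · push_cast; field_simp
    · simp
  · rw [if_neg (fun hz : Zp Q C n y => hyC hz.2.1), Finset.sum_eq_zero, mul_zero]
    intro x _
    rw [Ind_apply, if_neg, mul_zero]
    intro hh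
    have h1 := C.zsmul_mem hh n
    rw [smul_add, smul_sub, hnn, sub_self, zero_add, D.n2 x x.2] at h1
    exact hyC ((AddSubgroup.add_mem_cancel_right C h1).1 hh)

lemma Zp.mono {Q : M → QZ} (h : IsQM Q) {C : AddSubgroup M} (hC : Iso Q C) {n : ℤ} {y x : M}
    (hy : Zp Q C n y) (hx : x ∈ C ⊔ AddSubgroup.zmultiples y) : Zp Q C n x := by
  have h0 := Iso.sup h hC hy.2.2 hy.1 x hx
  obtain ⟨c, hc, z, hz, rfl⟩ := AddSubgroup.mem_sup.1 hx
  obtain ⟨i, rfl⟩ := AddSubgroup.mem_zmultiples_iff.1 hz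
  refine ⟨fun c' hc' => ?_, ?_, h0⟩
  · rw [h.bil, hC.orth hc hc', h.zsl, hy.1 c' hc', smul_zero, add_zero]
  · have : c + i • y - n • (c + i • y) = (c - n • c) + i • (y - n • y) := by
      rw [smul_add, smul_sub, smul_comm n i]; abel
    rw [this]
    exact C.add_mem (C.sub_mem hc (C.zsmul_mem hc n)) (C.zsmul_mem hy.2.1 i)

lemma coprime_mem {C : AddSubgroup M} {y : M} {i j : ℤ} (hij : IsCoprime i j)
    (hi : i • y ∈ C) (hj : j • y ∈ C) : y ∈ C := by
  obtain ⟨u, v, huv⟩ := hij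
  have : y = u • i • y + v • j • y := by
    rw [smul_smul, smul_smul, ← add_smul, huv, one_smul]
  rw [this]
  exact C.add_mem (C.zsmul_mem hi u) (C.zsmul_mem hj v)

lemma g_eq {C : AddSubgroup M} {p j : ℕ} (hp : p.Prime) {y : M}
    (hy : y ∉ C) (hj : ((p ^ j : ℕ) : ℤ) • y ∈ C) :
    (fun x => if C ⊔ AddSubgroup.zmultiples x = C ⊔ AddSubgroup.zmultiples y
      then (1 : ℂ) else 0) =
    Ind (C ⊔ AddSubgroup.zmultiples y) - Ind (C ⊔ AddSubgroup.zmultiples ((p : ℤ) • y)) := by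
  have hFE : C ⊔ AddSubgroup.zmultiples ((p : ℤ) • y) ≤ C ⊔ AddSubgroup.zmultiples y :=
    sup_le_sup_left (AddSubgroup.zmultiples_le.2
      (AddSubgroup.zsmul_mem _ (AddSubgroup.mem_zmultiples y) _)) C
  have hpi : Prime (p : ℤ) := Nat.prime_iff_prime_int.1 hp
  have hiff : ∀ x, C ⊔ AddSubgroup.zmultiples x = C ⊔ AddSubgroup.zmultiples y ↔
      x ∈ C ⊔ AddSubgroup.zmultiples y ∧ x ∉ C ⊔ AddSubgroup.zmultiples ((p : ℤ) • y) := by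
    intro x
    constructor
    · intro hh
      refine ⟨hh ▸ AddSubgroup.mem_sup_right (AddSubgroup.mem_zmultiples x), fun hx => ?_⟩
      have h1 : y ∈ C ⊔ AddSubgroup.zmultiples x :=
        hh ▸ AddSubgroup.mem_sup_right (AddSubgroup.mem_zmultiples y)
      have h2 : C ⊔ AddSubgroup.zmultiples x ≤ C ⊔ AddSubgroup.zmultiples ((p : ℤ) • y) :=
        sup_le le_sup_left (AddSubgroup.zmultiples_le.2 hx)
      obtain ⟨c, hc, z, hz, hcz⟩ := AddSubgroup.mem_sup.1 (h2 h1)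
      obtain ⟨i, rfl⟩ := AddSubgroup.mem_zmultiples_iff.1 hz
      have h3 : (1 - i * p : ℤ) • y ∈ C := by
        have : (1 - i * p : ℤ) • y = c := by
          rw [sub_smul, one_smul, mul_smul]
          nth_rewrite 1 [← hcz]
          abel
        rw [this]; exact hc
      refine hy (coprime_mem ?_ h3 hj)
      push_cast
      apply IsCoprime.pow_right
      exact ⟨1, i, by ring⟩
    · rintro ⟨hx, hxF⟩
      apply le_antisymm
      · exact sup_le le_sup_left (AddSubgroup.zmultiples_le.2 hx)
      · refine sup_le le_sup_left (AddSubgroup.zmultiples_le.2 ?_)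
        obtain ⟨c, hc, z, hz, rfl⟩ := AddSubgroup.mem_sup.1 hx
        obtain ⟨i, rfl⟩ := AddSubgroup.mem_zmultiples_iff.1 hz
        have hpn : ¬ (p : ℤ) ∣ i := by
          rintro ⟨r, rfl⟩
          apply hxF
          refine AddSubgroup.mem_sup.2 ⟨c, hc, _,
            AddSubgroup.zsmul_mem _ (AddSubgroup.mem_zmultiples _) r, ?_⟩
          rw [smul_smul, mul_comm]
        refine coprime_mem (i := i) (j := ((p ^ j : ℕ) : ℤ)) ?_ ?_
          (AddSubgroup.mem_sup_left hj)
        · push_cast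
          apply IsCoprime.pow_right
          exact ((Prime.coprime_iff_not_dvd hpi).2 hpn).symm
        · have h6 := AddSubgroup.sub_mem (C ⊔ AddSubgroup.zmultiples (c + i • y))
            (AddSubgroup.mem_sup_right (AddSubgroup.mem_zmultiples (c + i • y)))
            (AddSubgroup.mem_sup_left hc)
          rwa [add_sub_cancel_left] at h6
  ext x
  simp only [Pi.sub_apply, Ind_apply, hiff]
  by_cases h1 : x ∈ C ⊔ AddSubgroup.zmultiples ((p : ℤ) • y)
  · rw [if_neg (fun hh => hh.2 h1), if_pos (hFE h1), if_pos h1, sub_self]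
  · simp only [h1, not_false_eq_true, and_true, if_false, sub_zero]

lemma Z_decomp [Fintype M] {Q : M → QZ} (h : IsQM Q) {A : AddSubgroup M} {p j k : ℕ} {n : ℤ}
    (D : IsPD Q A p j k n) {C : AddSubgroup M} (hC : Iso Q C) :
    ∃ c : ℝ, (fun y => if Zp Q C n y then (1 : ℂ) else 0) - (c : ℂ) • Ind C ∈
      Submodule.span ℂ (Ind '' {E : AddSubgroup M | Iso Q E ∧ C < E}) ∧
      ((∃ y ∈ A, Q y = 0 ∧ (∀ c ∈ C, Bf Q y c = 0) ∧ y ∉ C) → c ≤ 0) := by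
  set W := Submodule.span ℂ (Ind '' {E : AddSubgroup M | Iso Q E ∧ C < E}) with hW
  set EE := univ.filter (fun E : AddSubgroup M =>
    ∃ y, Zp Q C n y ∧ E = C ⊔ AddSubgroup.zmultiples y) with hEE
  let d : AddSubgroup M → ℝ := fun E =>
    if E = C then 1 else if ∀ x ∈ E, (p : ℤ) • x ∈ C then -1 else 0
  refine ⟨∑ E ∈ EE, d E, ?_, ?_⟩
  · have h1 : (fun y => if Zp Q C n y then (1 : ℂ) else 0) =
        ∑ E ∈ EE, (fun x => if C ⊔ AddSubgroup.zmultiples x = E then (1 : ℂ) else 0) := by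
      ext x
      rw [Finset.sum_apply, Finset.sum_ite_eq]
      have : Zp Q C n x ↔ C ⊔ AddSubgroup.zmultiples x ∈ EE := by
        simp only [hEE, Finset.mem_filter, Finset.mem_univ, true_and]
        constructor
        · intro hx; exact ⟨x, hx, rfl⟩
        · rintro ⟨y, hy, hxy⟩
          refine hy.mono h hC ?_
          rw [← hxy]
          exact AddSubgroup.mem_sup_right (AddSubgroup.mem_zmultiples x)
      simp only [this]
    rw [h1, Complex.ofReal_sum, Finset.sum_smul, ← Finset.sum_sub_distrib]
    refine Submodule.sum_mem _ fun E hE => ?_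
    obtain ⟨y, hy, rfl⟩ := (Finset.mem_filter.1 hE).2
    by_cases hyC : y ∈ C
    · have e1 : C ⊔ AddSubgroup.zmultiples y = C :=
        sup_eq_left.2 (AddSubgroup.zmultiples_le.2 hyC)
      have e2 : (fun x => if C ⊔ AddSubgroup.zmultiples x = C then (1 : ℂ) else 0) = Ind C := by
        ext x
        rw [Ind_apply]
        simp only [sup_eq_left, AddSubgroup.zmultiples_le]
      have e3 : d C = 1 := by simp [d]
      rw [e1, e2, e3]
      simp
    · have hj : ((p ^ j : ℕ) : ℤ) • y ∈ C := by
        have : ((p ^ j : ℕ) : ℤ) • y = ((p ^ j : ℕ) : ℤ) • (y - n • y) := by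
          rw [smul_sub, natCast_zsmul, natCast_zsmul, D.hpj _ (D.n1 y), sub_zero]
        rw [this]
        exact C.zsmul_mem hy.2.1 _
      rw [g_eq D.hp hyC hj]
      have hlt : C < C ⊔ AddSubgroup.zmultiples y := by
        rw [left_lt_sup, AddSubgroup.zmultiples_le]; exact hyC
      have hE1 : Ind (C ⊔ AddSubgroup.zmultiples y) ∈ W :=
        Submodule.subset_span ⟨_, ⟨Iso.sup h hC hy.2.2 hy.1, hlt⟩, rfl⟩
      by_cases hpy : (p : ℤ) • y ∈ C
      · have e1 : C ⊔ AddSubgroup.zmultiples ((p : ℤ) • y) = C :=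
          sup_eq_left.2 (AddSubgroup.zmultiples_le.2 hpy)
        have e2 : d (C ⊔ AddSubgroup.zmultiples y) = -1 := by
          simp only [d]
          rw [if_neg hlt.ne', if_pos]
          intro x hx
          obtain ⟨c, hc, z, hz, rfl⟩ := AddSubgroup.mem_sup.1 hx
          obtain ⟨i, rfl⟩ := AddSubgroup.mem_zmultiples_iff.1 hz
          rw [smul_add, smul_comm]
          exact C.add_mem (C.zsmul_mem hc _) (C.zsmul_mem hpy _)
        rw [e1, e2]
        have : Ind (C ⊔ AddSubgroup.zmultiples y) - Ind C - ((-1 : ℝ) : ℂ) • Ind C =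
            Ind (C ⊔ AddSubgroup.zmultiples y) := by
          simp
        rw [this]; exact hE1
      · have e2 : d (C ⊔ AddSubgroup.zmultiples y) = 0 := by
          simp only [d]
          rw [if_neg hlt.ne', if_neg]
          intro hh
          exact hpy (hh y (AddSubgroup.mem_sup_right (AddSubgroup.mem_zmultiples y)))
        rw [e2, Complex.ofReal_zero, zero_smul, sub_zero]
        refine W.sub_mem hE1 (Submodule.subset_span ⟨_, ⟨?_, ?_⟩, rfl⟩)
        · refine Iso.sup h hC (h.Qz _ hy.2.2) (fun c hc => ?_)
          rw [h.zsl, hy.1 c hc, smul_zero]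
        · rw [left_lt_sup, AddSubgroup.zmultiples_le]; exact hpy
  · rintro ⟨y, hyA, hy0, hyC, hy⟩
    have hex : ∃ i, ((p ^ i : ℕ) : ℤ) • y ∈ C := ⟨j, by
      rw [natCast_zsmul, D.hpj y hyA]; exact C.zero_mem⟩
    set i := Nat.find hex with hi
    have hi1 := Nat.find_spec hex
    rw [← hi] at hi1
    have hipos : i ≠ 0 := by
      intro h0
      rw [h0] at hi1
      exact hy (by simpa using hi1)
    obtain ⟨r, hr⟩ := Nat.exists_eq_succ_of_ne_zero hipos
    have hr1 : ((p ^ r : ℕ) : ℤ) • y ∉ C := Nat.find_min hex (by omega)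
    set y0 := ((p ^ r : ℕ) : ℤ) • y with hy0'
    have hpy0 : (p : ℤ) • y0 ∈ C := by
      rw [hy0', smul_smul]
      rw [hr] at hi1
      convert hi1 using 2
      push_cast
      rw [Nat.succ_eq_add_one, pow_succ, mul_comm]
    have hZ : Zp Q C n y0 := by
      refine ⟨fun c hc => by rw [h.zsl, hyC c hc, smul_zero], ?_, h.Qz _ hy0⟩
      rw [D.n2 y0 (A.zsmul_mem hyA _), sub_self]; exact C.zero_mem
    have hZ0 : Zp Q C n 0 := ⟨fun c _ => h.zl c, by simp, h.Q0⟩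
    have hCE : C ∈ EE := Finset.mem_filter.2 ⟨Finset.mem_univ _, 0, hZ0, by simp⟩
    set E0 := C ⊔ AddSubgroup.zmultiples y0 with hE0
    have hlt : C < E0 := by
      rw [hE0, left_lt_sup, AddSubgroup.zmultiples_le]; exact hr1
    have hE0E : E0 ∈ EE.erase C := Finset.mem_erase.2 ⟨hlt.ne',
      Finset.mem_filter.2 ⟨Finset.mem_univ _, y0, hZ, rfl⟩⟩
    have e2 : d E0 = -1 := by
      simp only [d]
      rw [if_neg hlt.ne', if_pos]
      intro x hx
      obtain ⟨c, hc, z, hz, rfl⟩ := AddSubgroup.mem_sup.1 hx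
      obtain ⟨i, rfl⟩ := AddSubgroup.mem_zmultiples_iff.1 hz
      rw [smul_add, smul_comm]
      exact C.add_mem (C.zsmul_mem hc _) (C.zsmul_mem hpy0 _)
    have e3 : d C = 1 := by simp [d]
    rw [← Finset.add_sum_erase _ _ hCE, ← Finset.add_sum_erase _ _ hE0E, e2, e3]
    have : ∑ E ∈ (EE.erase C).erase E0, d E ≤ 0 := by
      refine Finset.sum_nonpos fun E hE => ?_
      have : E ≠ C := (Finset.mem_erase.1 (Finset.mem_of_mem_erase hE)).1
      simp only [d]
      rw [if_neg this]
      split_ifs <;> norm_num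
    linarith

lemma X_decomp [Fintype M] {Q : M → QZ} (h : IsQM Q) {A : AddSubgroup M} {p j k : ℕ} {n : ℤ}
    (D : IsPD Q A p j k n) {C : AddSubgroup M} (hC : Iso Q C) :
    ∃ c : ℝ, Xop Q A n k (Ind C) - (c : ℂ) • Ind C ∈
      Submodule.span ℂ (Ind '' {E : AddSubgroup M | Iso Q E ∧ C < E}) ∧
      ((∃ y ∈ A, Q y = 0 ∧ (∀ c ∈ C, Bf Q y c = 0) ∧ y ∉ C) → c ≤ 0) := by
  obtain ⟨c, h1, h2⟩ := Z_decomp h D hC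
  refine ⟨(Fintype.card (C ⊓ A : AddSubgroup M) / k : ℝ) * c, ?_, fun hh => ?_⟩
  · rw [Xop_Ind h D hC, Complex.ofReal_mul, mul_smul, ← smul_sub]
    exact Submodule.smul_mem _ _ h1
  · exact mul_nonpos_of_nonneg_of_nonpos (by positivity) (h2 hh)

lemma final_induction [Fintype M] {Q : M → QZ} (h : IsQM Q) (hP : AllPD Q) (lam : M → ℂ)
    (hT : ∀ x, lam x ≠ 0 → Q x = 0) (c : ℂ)
    (hS : ∀ v, lam v = c * ∑ w, ee (-(Bf Q v w)) * lam w) (N : ℕ) :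
    ∀ S : Set (AddSubgroup M), S.ncard = N → (∀ C ∈ S, Iso Q C) →
      (∀ C ∈ S, ∀ E, Iso Q E → C ≤ E → E ∈ S) → lam ∈ Submodule.span ℂ (Ind '' S) →
      lam ∈ Submodule.span ℂ (Ind '' {C : AddSubgroup M | Iso Q C ∧ SD Q C}) := by
  induction N with
  | zero =>
    intro S hN hI _ hl
    rw [Set.ncard_eq_zero] at hN
    refine Submodule.span_mono (Set.image_mono ?_) hl
    rw [hN]; exact Set.empty_subset _
  | succ N ih =>
    intro S hN hI hup hl
    by_cases hall : ∀ C ∈ S, SD Q C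
    · have hsub : S ⊆ {C : AddSubgroup M | Iso Q C ∧ SD Q C} := by
        intro C hC
        exact ⟨hI C hC, hall C hC⟩
      exact Submodule.span_mono (Set.image_mono hsub) hl
    push Not at hall
    obtain ⟨C, hCm⟩ := Set.Finite.exists_minimal (Set.toFinite {C | C ∈ S ∧ ¬ SD Q C}) hall
    obtain ⟨⟨hCS, hCSD⟩, hmin⟩ := hCm
    have hCI := hI C hCS
    have hminS : ∀ E ∈ S, ¬ E < C := by
      intro E hE hlt
      by_cases hES : SD Q E
      · apply hlt.not_ge
        intro x hx
        exact (hES x).2 fun e he => hCI.orth (hlt.le he) hx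
      · exact hlt.not_ge (hmin ⟨hE, hES⟩ hlt.le)
    obtain ⟨p, hp, y, hyA, hy⟩ := exists_local h hP hCI hCSD
    obtain ⟨j, k, n, D, -⟩ := hP p hp
    obtain ⟨r, hr1, hr2⟩ := X_decomp h D hCI
    have hr := hr2 ⟨y, hyA, hy⟩
    set X := Xop Q (primaryComp M p) n k
    set S' := S \ {C}
    refine ih S' ?_ (fun E hE => hI E hE.1) ?_ ?_
    · have : S'.ncard + 1 = S.ncard := Set.ncard_sdiff_singleton_add_one hCS (Set.toFinite S)
      omega
    · intro E hE F hF hEF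
      refine ⟨hup E hE.1 F hF hEF, ?_⟩
      rintro rfl
      exact hminS E hE.1 (lt_of_le_of_ne hEF hE.2)
    · have hmap : Submodule.map (X - (r : ℂ) • LinearMap.id) (Submodule.span ℂ (Ind '' S)) ≤
          Submodule.span ℂ (Ind '' S') := by
        rw [Submodule.map_span_le]
        rintro _ ⟨E, hE, rfl⟩
        have hsub : ∀ E ∈ S, Submodule.span ℂ (Ind '' {F : AddSubgroup M | Iso Q F ∧ E < F}) ≤
            Submodule.span ℂ (Ind '' S') := by
          intro E hE
          refine Submodule.span_mono (Set.image_mono ?_)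
          rintro F ⟨hF, hEF⟩
          refine ⟨hup E hE F hF hEF.le, ?_⟩
          rintro rfl
          exact hminS E hE hEF
        simp only [LinearMap.sub_apply, LinearMap.smul_apply, LinearMap.id_apply]
        by_cases hEC : E = C
        · rw [hEC]; exact hsub C hCS hr1
        · obtain ⟨s, hs, -⟩ := X_decomp h D (hI E hE)
          have e1 : X (Ind E) - (r : ℂ) • Ind E =
              (X (Ind E) - (s : ℂ) • Ind E) + ((s : ℂ) - r) • Ind E := by
            rw [sub_smul]; abel
          rw [e1]
          exact Submodule.add_mem _ (hsub E hE hs) (Submodule.smul_mem _ _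
            (Submodule.subset_span ⟨E, ⟨hE, hEC⟩, rfl⟩))
      have h1 := hmap (Submodule.mem_map_of_mem hl)
      simp only [LinearMap.sub_apply, LinearMap.smul_apply, LinearMap.id_apply] at h1
      rw [Xop_inv h D lam hT c hS] at h1
      have h2 : lam - (r : ℂ) • lam = ((1 - r : ℝ) : ℂ) • lam := by
        push_cast; rw [sub_smul, one_smul]
      rw [h2] at h1
      have h3 : ((1 - r : ℝ) : ℂ) ≠ 0 := by
        have : (1 - r) ≠ 0 := by linarith
        exact_mod_cast this
      exact (Submodule.smul_mem_iff _ h3).1 h1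

end Helpers

/-- if `|M|` is a perfect square and `σ_p(M) = 1` for all primes `p`,
then `Inv(M) ≠ 0`, and `Inv(M)` is spanned by the indicator functions of the
isotropic self-dual subgroups of `M`. -/
theorem invariants_spanned_by_selfdual {M : Type} [AddCommGroup M] [Finite M]
    (Q : M → QZ)
    (hquad : ∀ (n : ℤ) (x : M), Q (n • x) = (n ^ 2 : ℤ) • Q x)
    (hbil : ∀ x x' y : M, Bf Q (x + x') y = Bf Q x y + Bf Q x' y)
    (hnd : ∀ x : M, (∀ y : M, Bf Q x y = 0) → x = 0)
    (hsq : ∃ k : ℕ, Nat.card M = k ^ 2)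
    (hsig : ∀ p : ℕ, p.Prime →
      gaussSigma (fun x : primaryComp M p => Q (x : M)) = 1) :
    (∃ lam : M → ℂ, lam ≠ 0 ∧ Tweil Q lam = lam ∧ Sweil Q lam = lam) ∧
    (∀ lam : M → ℂ, Tweil Q lam = lam → Sweil Q lam = lam →
      lam ∈ Submodule.span ℂ {f : M → ℂ | ∃ U : AddSubgroup M,
        (∀ x ∈ U, Q x = 0) ∧ (∀ y : M, y ∈ U ↔ ∀ x ∈ U, Bf Q x y = 0) ∧
        f = (U : Set M).indicator 1}) := by
  classical
  have := Fintype.ofFinite M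
  have h : IsQM Q := ⟨hquad, hbil, hnd⟩
  have hP : AllPD Q := allPD Q hsq hsig
  obtain ⟨U, hUI, hU⟩ := exists_SD h hP
  refine ⟨⟨Ind U, ?_, SD_inv h hUI hU⟩, ?_⟩
  · intro h0
    have h1 := congrFun h0 0
    rw [Ind_apply, if_pos U.zero_mem] at h1
    exact one_ne_zero h1
  · intro lam hTl hSl
    have hT := inv_T hTl
    have hS : ∀ v, lam v = (gaussSigma Q * ((Real.sqrt (Nat.card M) : ℂ))⁻¹) *
        ∑ w, ee (-(Bf Q v w)) * lam w := by
      intro v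
      have h1 := congrFun hSl v
      rw [Sweil, finsum_eq_sum_of_fintype] at h1
      exact h1.symm
    obtain ⟨hG, -⟩ := SD_gauss h hUI hU
    have hu := unit_inv h Fintype.card_ne_zero hG lam hT _ hS
    have hl := inv_span h lam hT (gen_inv lam hu)
    have hfin := final_induction h hP lam hT _ hS _ {C | Iso Q C} rfl (fun C hC => hC)
      (fun C _ E hE _ => hE) hl
    refine Submodule.span_mono ?_ hfin
    rintro _ ⟨C, ⟨hC1, hC2⟩, rfl⟩
    exact ⟨C, hC1, hC2, rfl⟩
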